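/- Optimized (parameter-free) Hoeffding PAC-Bayes bound: Let μ be any probability distribution on 𝒜 (a prior policy, independent of H^t) and let ε ∈ (0,1] satisfy π_n(a) ≥ ε almost surely for all a ∈ 𝒜 and all n ∈ {1,…,t}. Then for any β ∈ (0,1), with probability at least 1 − β over the draw of H^t, simultaneously for all probability distributions π on 𝒜 (including ones chosen as a function of H^t): |r̄(π) − r̂^IS(π, H^t)| ≤ (1/ε) · √((KL(π‖μ) + ln(4𝛑/(3β)))/t), where 𝛑 = 3.14159… is the circle constant. -/

import Mathlib

open MeasureTheory Real

namespace OfflineBandits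

/-- The σ-algebra generated by the history `H^n = (A_1, R_1, …, A_n, R_n)`
(trivial for `n = 0`). -/
def hist {Ω 𝒜 : Type*} [MeasurableSpace 𝒜] (A : ℕ → Ω → 𝒜) (R : ℕ → Ω → ℝ)
    (n : ℕ) : MeasurableSpace Ω :=
  MeasurableSpace.comap (fun ω => fun i : Fin n => (A (i.1 + 1) ω, R (i.1 + 1) ω)) inferInstance

/-- `p` is a probability mass function on the finite action set `𝒜`. -/
def IsPMF {𝒜 : Type*} [Fintype 𝒜] (p : 𝒜 → ℝ) : Prop :=
  (∀ a, 0 ≤ p a) ∧ ∑ a, p a = 1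

/-- Relative entropy (KL divergence) between two pmfs on a finite set. -/
noncomputable def KL {𝒜 : Type*} [Fintype 𝒜] (p q : 𝒜 → ℝ) : ℝ :=
  ∑ a, p a * Real.log (p a / q a)

/-- Importance-sampling estimate `r̂^IS(a, H^t)` of the expected reward of action `a`. -/
noncomputable def rIS {Ω 𝒜 : Type*} [DecidableEq 𝒜] (A : ℕ → Ω → 𝒜) (R : ℕ → Ω → ℝ)
    (pol : ℕ → Ω → 𝒜 → ℝ) (t : ℕ) (a : 𝒜) (ω : Ω) : ℝ :=
  (t : ℝ)⁻¹ * ∑ n ∈ Finset.Icc 1 t, (if A n ω = a then 1 else 0) / pol n ω (A n ω) * R n ω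

/-- Importance-sampling estimate `r̂^IS(π, H^t)` of the expected reward of a policy. -/
noncomputable def rISPol {Ω 𝒜 : Type*} [Fintype 𝒜] [DecidableEq 𝒜] (A : ℕ → Ω → 𝒜) (R : ℕ → Ω → ℝ)
    (pol : ℕ → Ω → 𝒜 → ℝ) (t : ℕ) (p : 𝒜 → ℝ) (ω : Ω) : ℝ :=
  ∑ a, p a * rIS A R pol t a ω

/-- Expected reward `r̄(π)` of a policy `π`. -/
def rPol {𝒜 : Type*} [Fintype 𝒜] (rbar : 𝒜 → ℝ) (p : 𝒜 → ℝ) : ℝ :=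
  ∑ a, p a * rbar a

/-- The martingale difference `Z_n^IS(a)`. -/
noncomputable def Zis {Ω 𝒜 : Type*} [DecidableEq 𝒜] (A : ℕ → Ω → 𝒜) (R : ℕ → Ω → ℝ)
    (pol : ℕ → Ω → 𝒜 → ℝ) (rbar : 𝒜 → ℝ) (a : 𝒜) (n : ℕ) (ω : Ω) : ℝ :=
  (if A n ω = a then 1 else 0) / pol n ω (A n ω) * R n ω - rbar a

/-- The cumulative conditional variance `V_t^IS(a)` of the IS martingale. -/
noncomputable def Vis {Ω 𝒜 : Type*} [MeasurableSpace Ω] [MeasurableSpace 𝒜] [DecidableEq 𝒜]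
    (P : Measure Ω) (A : ℕ → Ω → 𝒜) (R : ℕ → Ω → ℝ)
    (pol : ℕ → Ω → 𝒜 → ℝ) (rbar : 𝒜 → ℝ) (t : ℕ) (a : 𝒜) (ω : Ω) : ℝ :=
  ∑ n ∈ Finset.Icc 1 t, (P[fun ω' => (Zis A R pol rbar a n ω') ^ 2 | hist A R (n - 1)]) ω


theorem two_point (q s : ℝ) (h0 : 0 ≤ q) (h1 : q ≤ 1) :
    exp (-(s * q)) * (1 - q + q * exp s) ≤ exp (s ^ 2 / 8) := by
  let ν : Measure ℝ := ENNReal.ofReal (1 - q) • Measure.dirac (-q) + ENNReal.ofReal q • Measure.dirac (1 - q)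
  have hν : IsProbabilityMeasure ν := ⟨by
    simp only [ν, Measure.add_apply, Measure.smul_apply, measure_univ, smul_eq_mul, mul_one]
    rw [← ENNReal.ofReal_add (by linarith) h0]; simp⟩
  have hint : ∀ f : ℝ → ℝ, ∫ x, f x ∂ν = (1 - q) * f (-q) + q * f (1 - q) := by
    intro f
    have i1 : Integrable f (ENNReal.ofReal (1 - q) • Measure.dirac (-q)) :=
      (integrable_dirac (by simp)).smul_measure (by simp)
    have i2 : Integrable f (ENNReal.ofReal q • Measure.dirac (1 - q)) :=
      (integrable_dirac (by simp)).smul_measure (by simp)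
    rw [integral_add_measure i1 i2, integral_smul_measure, integral_smul_measure, integral_dirac,
      integral_dirac, ENNReal.toReal_ofReal h0, ENNReal.toReal_ofReal (by linarith)]
    simp
  have h := ProbabilityTheory.hasSubgaussianMGF_of_mem_Icc_of_integral_eq_zero (μ := ν) (X := fun x => x)
    (a := -q) (b := 1 - q) (by fun_prop) (by
      simp only [ν]
      rw [ae_add_measure_iff]
      constructor
      · apply Measure.ae_smul_measure
        exact (ae_dirac_iff measurableSet_Icc).2 (by constructor <;> linarith)
      · apply Measure.ae_smul_measure
        exact (ae_dirac_iff measurableSet_Icc).2 (by constructor <;> linarith)) (by rw [hint]; ring)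
  have h2 := h.mgf_le s
  rw [ProbabilityTheory.mgf, hint] at h2
  have e1 : exp (-(s * q)) * (1 - q + q * exp s) = (1 - q) * exp (s * -q) + q * exp (s * (1 - q)) := by
    rw [show s * (1 - q) = -(s * q) + s by ring, exp_add, show s * -q = -(s*q) by ring]; ring
  rw [e1]
  refine h2.trans (le_of_eq ?_)
  congr 1
  simp
  ring

theorem dv_step {𝒜 : Type*} [Fintype 𝒜] (p μ f : 𝒜 → ℝ) (hp : ∀ a, 0 ≤ p a) (hp1 : ∑ a, p a = 1)
    (hμ : ∀ a, 0 ≤ μ a) (hac : ∀ a, μ a = 0 → p a = 0) (C : ℝ) (hC : 0 < C)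
    (h : ∑ a, μ a * exp (f a) ≤ C) :
    ∑ a, p a * f a ≤ ∑ a, p a * log (p a / μ a) + log C := by
  have key : ∀ a, p a * f a - p a * log (p a / μ a) - p a * log C ≤ μ a * exp (f a) / C - p a := by
    intro a
    rcases (hp a).eq_or_lt with h0 | h0
    · rw [← h0]; simp; have := hμ a; positivity
    · have hm : 0 < μ a := lt_of_le_of_ne (hμ a) (fun hh => h0.ne' (hac a hh.symm))
      have := Real.log_le_sub_one_of_pos (x := μ a * exp (f a) / (C * p a)) (by positivity)
      rw [log_div (by positivity) (by positivity), log_mul (by positivity) (by positivity),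
        log_mul (by positivity) (by positivity), log_exp] at this
      rw [log_div (by positivity) (by positivity)]
      have h3 := mul_le_mul_of_nonneg_left this h0.le
      have e : p a * (μ a * exp (f a) / (C * p a) - 1) = μ a * exp (f a) / C - p a := by
        field_simp
      rw [e] at h3
      linarith
  have := Finset.sum_le_sum (fun a (_ : a ∈ Finset.univ) => key a)
  rw [Finset.sum_sub_distrib, Finset.sum_sub_distrib, Finset.sum_sub_distrib, ← Finset.sum_mul,
    ← Finset.sum_div, hp1, one_mul] at this
  have h5 : (∑ a, μ a * exp (f a)) / C ≤ 1 := by rw [div_le_one hC]; exact h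
  linarith

theorem jensen_sq {𝒜 : Type*} [Fintype 𝒜] (p f : 𝒜 → ℝ) (hp : ∀ a, 0 ≤ p a) (hp1 : ∑ a, p a = 1) :
    (∑ a, p a * f a) ^ 2 ≤ ∑ a, p a * f a ^ 2 := by
  have h := Finset.sum_nonneg (fun a (_ : a ∈ Finset.univ) =>
    mul_nonneg (hp a) (sq_nonneg (f a - ∑ b, p b * f b)))
  set m := ∑ b, p b * f b with hm
  have e : ∑ a, p a * (f a - m) ^ 2 = ∑ a, p a * f a ^ 2 - 2 * m * ∑ a, p a * f a + m ^ 2 * ∑ a, p a := by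
    rw [Finset.mul_sum (f := p), Finset.mul_sum _ _ (2 * m), ← Finset.sum_sub_distrib,
      ← Finset.sum_add_distrib]
    exact Finset.sum_congr rfl fun a _ => by ring
  rw [e, hp1, ← hm] at h
  nlinarith

theorem exp_sq_bound {Ω : Type*} [MeasurableSpace Ω] (P : Measure Ω) [IsProbabilityMeasure P]
    (Y : Ω → ℝ) (hY : Measurable Y)
    (h : ∀ x : ℝ, ∫⁻ ω, ENNReal.ofReal (exp (x * Y ω)) ∂P ≤ ENNReal.ofReal (exp (x ^ 2 / 2))) :
    ∫⁻ ω, ENNReal.ofReal (exp (Y ω ^ 2 / 4)) ∂P ≤ ENNReal.ofReal (√2) := by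
  have g1 : ∀ b : ℝ, 0 < b → ∫⁻ x : ℝ, ENNReal.ofReal (exp (-b * x ^ 2)) = ENNReal.ofReal (√(π / b)) := by
    intro b hb
    rw [← ofReal_integral_eq_lintegral_ofReal (integrable_exp_neg_mul_sq hb)
      (Filter.Eventually.of_forall fun x => (exp_pos _).le), integral_gaussian]
  have g2 : ∀ y : ℝ, ∫⁻ x : ℝ, ENNReal.ofReal (exp (x * y - x ^ 2)) =
      ENNReal.ofReal (√π) * ENNReal.ofReal (exp (y ^ 2 / 4)) := by
    intro y
    have := g1 1 one_pos
    rw [div_one] at this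
    rw [← this, ← lintegral_sub_right_eq_self (fun x : ℝ => ENNReal.ofReal (exp (-1 * x ^ 2))) (y / 2), ← lintegral_mul_const' _ _ (by simp)]
    congr 1; ext x
    rw [← ENNReal.ofReal_mul (exp_pos _).le, ← exp_add]
    congr 2; ring
  have hs : ∫⁻ ω, (∫⁻ x : ℝ, ENNReal.ofReal (exp (x * Y ω - x ^ 2))) ∂P =
      ∫⁻ x : ℝ, ∫⁻ ω, ENNReal.ofReal (exp (x * Y ω - x ^ 2)) ∂P := by
    apply lintegral_lintegral_swap
    apply Measurable.aemeasurable
    simp only [Function.uncurry_def]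
    fun_prop
  simp_rw [g2] at hs
  rw [lintegral_const_mul' _ _ (by simp)] at hs
  have h3 : ∫⁻ x : ℝ, ∫⁻ ω, ENNReal.ofReal (exp (x * Y ω - x ^ 2)) ∂P ≤ ENNReal.ofReal (√(π / (1/2))) := by
    rw [← g1 (1/2) (by norm_num)]
    apply lintegral_mono
    intro x
    dsimp only
    calc _ = ENNReal.ofReal (exp (-x^2)) * ∫⁻ ω, ENNReal.ofReal (exp (x * Y ω)) ∂P := by
          rw [← lintegral_const_mul' _ _ (by simp)]
          congr 1; ext ω
          rw [← ENNReal.ofReal_mul (exp_pos _).le, ← exp_add]; congr 2; ring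
      _ ≤ ENNReal.ofReal (exp (-x^2)) * ENNReal.ofReal (exp (x ^ 2 / 2)) := by gcongr; exact h x
      _ = _ := by
          rw [← ENNReal.ofReal_mul (exp_pos _).le, ← exp_add]; congr 2; ring
  rw [← hs, show π / (1/2) = π * 2 by ring, sqrt_mul pi_pos.le, ENNReal.ofReal_mul (by positivity)] at h3
  exact (ENNReal.mul_le_mul_iff_right (by simp [pi_pos]) (by simp)).1 h3

theorem step_mean {Ω 𝒜 : Type*} {m m0 : MeasurableSpace Ω} [Finite 𝒜] [DecidableEq 𝒜]
    [MeasurableSpace 𝒜] [MeasurableSingletonClass 𝒜]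
    (P : Measure Ω) [IsProbabilityMeasure P] (hm : m ≤ m0)
    (A : Ω → 𝒜) (R : Ω → ℝ) (hA : Measurable A) (hR : Measurable R)
    (hR01 : ∀ ω, R ω ∈ Set.Icc (0 : ℝ) 1) (a : 𝒜)
    (q : Ω → ℝ) (hq : Measurable[m] q)
    (hqc : (P[(fun ω => if A ω = a then (1 : ℝ) else 0) | m]) =ᵐ[P] q)
    (rbar : 𝒜 → ℝ)
    (hrew : (P[R | m ⊔ MeasurableSpace.comap A inferInstance]) =ᵐ[P] fun ω => rbar (A ω))
    (ε : ℝ) (hε0 : 0 < ε) (hεq : ∀ᵐ ω ∂P, ε ≤ q ω)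
    (W : Ω → ℝ) (hW : Measurable[m] W) (c : ℝ) (hWc : ∀ᵐ ω ∂P, ‖W ω‖ ≤ c) :
    ∫ ω, W ω * ((if A ω = a then 1 else 0) / q ω * R ω) ∂P = rbar a * ∫ ω, W ω ∂P := by
  have hAm : MeasurableSpace.comap A inferInstance ≤ m0 := hA.comap_le
  have hm' : m ⊔ MeasurableSpace.comap A inferInstance ≤ m0 := sup_le hm hAm
  have hind0 : Measurable (fun b : 𝒜 => if b = a then (1 : ℝ) else 0) := measurable_of_finite _
  have hind : Measurable[m ⊔ MeasurableSpace.comap A inferInstance] (fun ω => if A ω = a then (1 : ℝ) else 0) :=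
    Measurable.mono (hind0.comp (comap_measurable A)) le_sup_right le_rfl
  let V : Ω → ℝ := fun ω => W ω / q ω
  have hV : Measurable[m] V := hW.div hq
  have hVb : ∀ᵐ ω ∂P, ‖V ω‖ ≤ c / ε := by
    filter_upwards [hWc, hεq] with ω h1 h2
    simp only [V, norm_div]
    have : ε ≤ ‖q ω‖ := h2.trans (le_abs_self _)
    have hc : 0 ≤ c := (norm_nonneg _).trans h1
    gcongr
  let G : Ω → ℝ := fun ω => V ω * (if A ω = a then 1 else 0)
  have hG : Measurable[m ⊔ MeasurableSpace.comap A inferInstance] G :=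
    (hV.mono le_sup_left le_rfl).mul hind
  have hGb : ∀ᵐ ω ∂P, ‖G ω‖ ≤ c / ε := by
    filter_upwards [hVb] with ω h1
    simp only [G]
    split_ifs
    · simpa using h1
    · simpa using (norm_nonneg _).trans h1
  have hRi : Integrable R P := Integrable.of_mem_Icc 0 1 hR.aemeasurable (Filter.Eventually.of_forall hR01)
  have hindi : Integrable (fun ω => if A ω = a then (1 : ℝ) else 0) P :=
    Integrable.of_mem_Icc 0 1 (hind.mono hm' le_rfl).aemeasurable
      (Filter.Eventually.of_forall fun ω => by split_ifs <;> simp)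
  have s1 : ∫ ω, (G * R) ω ∂P = ∫ ω, G ω * rbar (A ω) ∂P := by
    rw [← integral_condExp hm']
    apply integral_congr_ae
    filter_upwards [condExp_stronglyMeasurable_mul_of_bound hm' hG.stronglyMeasurable hRi _ hGb, hrew] with ω h1 h2
    rw [h1, Pi.mul_apply, h2]
  have s2 : ∫ ω, (V * (fun ω => if A ω = a then (1 : ℝ) else 0)) ω ∂P = ∫ ω, W ω ∂P := by
    rw [← integral_condExp hm]
    apply integral_congr_ae
    filter_upwards [condExp_stronglyMeasurable_mul_of_bound hm hV.stronglyMeasurable hindi _ hVb, hqc, hεq] with ω h1 h2 h3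
    rw [h1, Pi.mul_apply, h2]
    exact div_mul_cancel₀ _ (by linarith)
  rw [← s2, ← integral_const_mul]
  calc _ = ∫ ω, (G * R) ω ∂P := by
        congr 1; ext ω; simp only [G, V, Pi.mul_apply]; ring
    _ = _ := s1
    _ = _ := by
        congr 1; ext ω; simp only [G, V, Pi.mul_apply]
        split_ifs with h
        · rw [h]; ring
        · simp

/-- one step of the exponential supermartingale -/
theorem step_exp {Ω : Type*} {m0 : MeasurableSpace Ω} 
    (P : Measure Ω) [IsProbabilityMeasure P] (X W : Ω → ℝ) (r ε l : ℝ) (hε0 : 0 < ε) (hε1 : ε ≤ 1)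
    (hr : r ∈ Set.Icc (0 : ℝ) 1) (hX : Measurable X) (hXb : ∀ᵐ ω ∂P, X ω ∈ Set.Icc 0 (1 / ε))
    (hW : Measurable W) (hW0 : ∀ ω, 0 ≤ W ω) (c : ℝ) (hWc : ∀ᵐ ω ∂P, ‖W ω‖ ≤ c)
    (hmean : ∫ ω, W ω * X ω ∂P = r * ∫ ω, W ω ∂P) :
    ∫ ω, W ω * exp (l * (X ω - r)) ∂P ≤ exp (l ^ 2 / (8 * ε ^ 2)) * ∫ ω, W ω ∂P := by
  have hWi : Integrable W P := Integrable.of_bound hW.aestronglyMeasurable c hWc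
  have hXW : Integrable (fun ω => W ω * X ω) P := by
    apply Integrable.of_bound (hW.mul hX).aestronglyMeasurable (c * (1 / ε))
    filter_upwards [hWc, hXb] with ω h1 h2
    rw [Pi.mul_apply, norm_mul]
    have hc : 0 ≤ c := (norm_nonneg _).trans h1
    have : ‖X ω‖ ≤ 1 / ε := by rw [Real.norm_eq_abs, abs_of_nonneg h2.1]; exact h2.2
    gcongr
  set s := l / ε with hs
  set q := r * ε with hq
  have hl : l = s * ε := by rw [hs]; field_simp
  have key := two_point q s (mul_nonneg hr.1 hε0.le) (by nlinarith [hr.1, hr.2])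
  have e1 : s ^ 2 / 8 = l ^ 2 / (8 * ε ^ 2) := by rw [hs]; field_simp
  rw [e1] at key
  have hWn : 0 ≤ ∫ ω, W ω ∂P := integral_nonneg hW0
  have hRHSi : Integrable (fun ω => exp (-(s * q)) * (W ω + (ε * (exp s - 1)) * (W ω * X ω))) P :=
    (hWi.add (hXW.const_mul _)).const_mul _
  calc _ ≤ ∫ ω, exp (-(s * q)) * (W ω + (ε * (exp s - 1)) * (W ω * X ω)) ∂P := by
        apply integral_mono_of_nonneg
        · exact Filter.Eventually.of_forall fun ω => mul_nonneg (hW0 ω) (exp_pos _).le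
        · exact hRHSi
        · filter_upwards [hXb] with ω h
          have hv0 : 0 ≤ ε * X ω := mul_nonneg hε0.le h.1
          have hv1 : ε * X ω ≤ 1 := by
            have := mul_le_mul_of_nonneg_left h.2 hε0.le
            rwa [mul_one_div_cancel hε0.ne'] at this
          have hcv := convexOn_exp.2 (Set.mem_univ 0) (Set.mem_univ s) (sub_nonneg.2 hv1) hv0 (by ring)
          simp only [smul_eq_mul, mul_zero, zero_add, exp_zero, mul_one] at hcv
          have e2 : exp (l * (X ω - r)) = exp (-(s * q)) * exp (ε * X ω * s) := by
            rw [← exp_add, hl, hq]; congr 1; ring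
          rw [e2]
          calc _ ≤ W ω * (exp (-(s * q)) * (1 - ε * X ω + ε * X ω * exp s)) := by
                have := hW0 ω
                gcongr
            _ = _ := by ring
    _ = (exp (-(s * q)) * (1 - q + q * exp s)) * ∫ ω, W ω ∂P := by
        rw [integral_const_mul, integral_add hWi (hXW.const_mul _), integral_const_mul, hmean, hq]; ring
    _ ≤ _ := by gcongr

theorem hist_le {Ω 𝒜 : Type*} [MeasurableSpace Ω] [MeasurableSpace 𝒜] (A : ℕ → Ω → 𝒜) (R : ℕ → Ω → ℝ)
    (hA : ∀ n, Measurable (A n)) (hR : ∀ n, Measurable (R n)) (n : ℕ) :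
    hist A R n ≤ (inferInstance : MeasurableSpace Ω) := by
  apply Measurable.comap_le
  exact measurable_pi_lambda _ fun i => (hA _).prodMk (hR _)

theorem hist_meas {Ω 𝒜 : Type*} [MeasurableSpace 𝒜] (A : ℕ → Ω → 𝒜) (R : ℕ → Ω → ℝ)
    (n i : ℕ) (h1 : 1 ≤ i) (h2 : i ≤ n) :
    Measurable[hist A R n] (fun ω => (A i ω, R i ω)) := by
  have h := (measurable_pi_apply (X := fun _ : Fin n => 𝒜 × ℝ) (⟨i - 1, by omega⟩ : Fin n)).comp
    (comap_measurable (fun ω => fun i : Fin n => (A (i.1 + 1) ω, R (i.1 + 1) ω)))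
  have e : i - 1 + 1 = i := by omega
  simp only [Function.comp_def, e] at h
  exact h

theorem hist_mono {Ω 𝒜 : Type*} [MeasurableSpace 𝒜] (A : ℕ → Ω → 𝒜) (R : ℕ → Ω → ℝ)
    (k n : ℕ) (h : k ≤ n) : hist A R k ≤ hist A R n := by
  apply Measurable.comap_le
  exact @measurable_pi_lambda _ _ _ (hist A R n) _ _ fun i =>
    hist_meas A R n (i.1 + 1) (by omega) (by omega)

theorem mgf_bound {Ω 𝒜 : Type*} [MeasurableSpace Ω] [Fintype 𝒜] [DecidableEq 𝒜]
    [MeasurableSpace 𝒜] [MeasurableSingletonClass 𝒜]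
    (P : Measure Ω) [IsProbabilityMeasure P]
    (t : ℕ)
    (A : ℕ → Ω → 𝒜) (R : ℕ → Ω → ℝ)
    (hA : ∀ n, Measurable (A n)) (hR : ∀ n, Measurable (R n))
    (hR01 : ∀ n ω, R n ω ∈ Set.Icc (0 : ℝ) 1)
    (pol : ℕ → Ω → 𝒜 → ℝ)
    (hpolMeas : ∀ n a, Measurable[hist A R (n - 1)] (fun ω => pol n ω a))
    (hpolCond : ∀ n, 1 ≤ n → n ≤ t → ∀ a : 𝒜,
      (P[(fun ω => if A n ω = a then (1 : ℝ) else 0) | hist A R (n - 1)])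
        =ᵐ[P] fun ω => pol n ω a)
    (rbar : 𝒜 → ℝ) (hrbar : ∀ a, rbar a ∈ Set.Icc (0 : ℝ) 1)
    (hrew : ∀ n, 1 ≤ n → n ≤ t →
      (P[R n | hist A R (n - 1) ⊔ MeasurableSpace.comap (A n) inferInstance])
        =ᵐ[P] fun ω => rbar (A n ω))
    (ε : ℝ) (hε0 : 0 < ε) (hε1 : ε ≤ 1)
    (hεpol : ∀ n, 1 ≤ n → n ≤ t → ∀ a : 𝒜, ∀ᵐ ω ∂P, ε ≤ pol n ω a) (a : 𝒜) (l : ℝ) :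
    ∀ n, n ≤ t →
    Measurable[hist A R n] (fun ω => ∑ i ∈ Finset.Icc 1 n, Zis A R pol rbar a i ω) ∧
    (∃ c, ∀ᵐ ω ∂P, ‖∑ i ∈ Finset.Icc 1 n, Zis A R pol rbar a i ω‖ ≤ c) ∧
    ∫ ω, exp (l * ∑ i ∈ Finset.Icc 1 n, Zis A R pol rbar a i ω) ∂P ≤ exp (l ^ 2 / (8 * ε ^ 2)) ^ n := by
  have hind0 : Measurable (fun b : 𝒜 => if b = a then (1 : ℝ) else 0) := measurable_of_finite _
  have hXe : ∀ n ω, (if A n ω = a then (1 : ℝ) else 0) / pol n ω (A n ω) * R n ω =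
      (if A n ω = a then (1 : ℝ) else 0) / pol n ω a * R n ω := by
    intro n ω
    split_ifs with h
    · rw [h]
    · simp
  have hZe : ∀ n ω, Zis A R pol rbar a n ω =
      (if A n ω = a then (1 : ℝ) else 0) / pol n ω a * R n ω - rbar a := by
    intro n ω
    rw [Zis, hXe]
  simp_rw [hZe]
  intro n
  induction n with
  | zero =>
    intro _
    refine ⟨by simp, ⟨0, by simp⟩, by simp⟩
  | succ n ih =>
    intro hn
    obtain ⟨h1, ⟨c, h2⟩, h3⟩ := ih (by omega)
    have hle := hist_le A R hA hR n
    have hX : Measurable[hist A R (n + 1)]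
        (fun ω => (if A (n + 1) ω = a then (1 : ℝ) else 0) / pol (n + 1) ω a * R (n + 1) ω) := by
      have hp := hist_meas A R (n + 1) (n + 1) (by omega) le_rfl
      have hp1 := hind0.comp (measurable_fst.comp hp)
      have hp2 := measurable_snd.comp hp
      exact (hp1.div ((hpolMeas (n + 1) a).mono (hist_mono A R _ _ (by omega)) le_rfl)).mul hp2
    have hXb : ∀ᵐ ω ∂P, (if A (n + 1) ω = a then (1 : ℝ) else 0) / pol (n + 1) ω a * R (n + 1) ω
        ∈ Set.Icc 0 (1 / ε) := by
      filter_upwards [hεpol (n + 1) (by omega) hn a] with ω h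
      have hr := hR01 (n + 1) ω
      have hpos : 0 < pol (n + 1) ω a := by linarith
      split_ifs
      · constructor
        · have := hr.1
          positivity
        · calc _ ≤ 1 / pol (n + 1) ω a * 1 := by gcongr; exact hr.2
            _ ≤ 1 / ε := by rw [mul_one]; gcongr
      · simp [hε0.le]
    simp_rw [Finset.sum_Icc_succ_top (show 1 ≤ n + 1 by omega)]
    refine ⟨?_, ⟨c + (1 / ε + 1), ?_⟩, ?_⟩
    · exact (h1.mono (hist_mono A R _ _ (by omega)) le_rfl).add (hX.sub measurable_const)
    · filter_upwards [h2, hXb] with ω g1 g2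
      refine (norm_add_le _ _).trans (add_le_add g1 ?_)
      rw [Real.norm_eq_abs, abs_le]
      have := hrbar a
      have h5 : 0 < 1 / ε := by positivity
      constructor <;> linarith [g2.1, g2.2, this.1, this.2]
    · set W : Ω → ℝ := fun ω => exp (l * ∑ i ∈ Finset.Icc 1 n,
        ((if A i ω = a then (1 : ℝ) else 0) / pol i ω a * R i ω - rbar a)) with hWdef
      have hW : Measurable[hist A R n] W := measurable_exp.comp (h1.const_mul l)
      have hWc : ∀ᵐ ω ∂P, ‖W ω‖ ≤ exp (|l| * c) := by
        filter_upwards [h2] with ω g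
        rw [hWdef, Real.norm_eq_abs, abs_exp]
        apply exp_le_exp.2
        refine (le_abs_self _).trans ?_
        rw [abs_mul]
        gcongr
        exact g
      have hmean := step_mean P hle (A (n + 1)) (R (n + 1)) (hA _) (hR _) (hR01 _) a
        (fun ω => pol (n + 1) ω a) (hpolMeas (n + 1) a) (hpolCond (n + 1) (by omega) hn a) rbar
        (hrew (n + 1) (by omega) hn) ε hε0 (hεpol (n + 1) (by omega) hn a) W hW _ hWc
      have := step_exp P _ W (rbar a) ε l hε0 hε1 (hrbar a)
        (hX.mono (hist_le A R hA hR _) le_rfl) hXb (hW.mono hle le_rfl)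
        (fun ω => (exp_pos _).le) _ hWc hmean
      calc _ = _ := by
            congr 1; ext ω
            rw [mul_add, exp_add]
        _ ≤ _ := this
        _ ≤ exp (l ^ 2 / (8 * ε ^ 2)) * exp (l ^ 2 / (8 * ε ^ 2)) ^ n := by gcongr
        _ = _ := by ring

/-- **Optimized (parameter-free) Hoeffding PAC-Bayes bound**
(Theorem 1 in "Refined PAC-Bayes Bounds for Offline Bandits"). -/
theorem optimized_hoeffding_pac_bayes_bound
    {Ω 𝒜 : Type*} [MeasurableSpace Ω] [Fintype 𝒜] [DecidableEq 𝒜]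
    [MeasurableSpace 𝒜] [MeasurableSingletonClass 𝒜]
    (P : Measure Ω) [IsProbabilityMeasure P]
    -- the horizon
    (t : ℕ) (ht : 1 ≤ t)
    -- the action and reward processes
    (A : ℕ → Ω → 𝒜) (R : ℕ → Ω → ℝ)
    (hA : ∀ n, Measurable (A n)) (hR : ∀ n, Measurable (R n))
    (hR01 : ∀ n ω, R n ω ∈ Set.Icc (0 : ℝ) 1)
    -- the logging policies: `ℱ_{n-1}`-measurable pmfs on `𝒜`
    (pol : ℕ → Ω → 𝒜 → ℝ)
    (hpolPMF : ∀ n ω, IsPMF (pol n ω))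
    (hpolMeas : ∀ n a, Measurable[hist A R (n - 1)] (fun ω => pol n ω a))
    -- the conditional distribution of `A_n` given `ℱ_{n-1}` is `π_n`
    (hpolCond : ∀ n, 1 ≤ n → n ≤ t → ∀ a : 𝒜,
      (P[(fun ω => if A n ω = a then (1 : ℝ) else 0) | hist A R (n - 1)])
        =ᵐ[P] fun ω => pol n ω a)
    -- the mean-reward function: `E[R_n | ℱ_{n-1}, A_n] = r̄(A_n)`
    (rbar : 𝒜 → ℝ) (hrbar : ∀ a, rbar a ∈ Set.Icc (0 : ℝ) 1)
    (hrew : ∀ n, 1 ≤ n → n ≤ t →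
      (P[R n | hist A R (n - 1) ⊔ MeasurableSpace.comap (A n) inferInstance])
        =ᵐ[P] fun ω => rbar (A n ω))
    -- a uniform lower bound on the logging policies
    (ε : ℝ) (hε0 : 0 < ε) (hε1 : ε ≤ 1)
    (hεpol : ∀ n, 1 ≤ n → n ≤ t → ∀ a : 𝒜, ∀ᵐ ω ∂P, ε ≤ pol n ω a)
    -- the prior policy
    (μ : 𝒜 → ℝ) (hμ : IsPMF μ)
    -- the confidence parameter
    (β : ℝ) (hβ : β ∈ Set.Ioo (0 : ℝ) 1) :
    (P {ω | ∀ p : 𝒜 → ℝ, IsPMF p → (∀ a, μ a = 0 → p a = 0) →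
        |rPol rbar p - rISPol A R pol t p ω| ≤
          (1 / ε) * Real.sqrt ((KL p μ + Real.log (4 * π / (3 * β))) / t)}).toReal
      ≥ 1 - β := by
  have htp : (0 : ℝ) < t := by exact_mod_cast ht
  have hst : 0 < √(t : ℝ) := sqrt_pos.2 htp
  have hZmeas : ∀ a, Measurable (fun ω => ∑ i ∈ Finset.Icc 1 t, Zis A R pol rbar a i ω) := fun a =>
    (mgf_bound P t A R hA hR hR01 pol hpolMeas hpolCond rbar hrbar hrew ε hε0 hε1 hεpol a 0 t le_rfl).1.mono
      (hist_le A R hA hR t) le_rfl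
  let Y : 𝒜 → Ω → ℝ := fun a ω => 2 * ε / √t * ∑ i ∈ Finset.Icc 1 t, Zis A R pol rbar a i ω
  have hYm : ∀ a, Measurable (Y a) := fun a => (hZmeas a).const_mul _
  have hYe : ∀ a, ∫⁻ ω, ENNReal.ofReal (exp (Y a ω ^ 2 / 4)) ∂P ≤ ENNReal.ofReal (√2) := by
    intro a
    refine exp_sq_bound P (Y a) (hYm a) fun x => ?_
    obtain ⟨-, ⟨c, hc⟩, h3⟩ := mgf_bound P t A R hA hR hR01 pol hpolMeas hpolCond rbar hrbar hrew ε
      hε0 hε1 hεpol a (x * (2 * ε / √t)) t le_rfl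
    have e1 : exp ((x * (2 * ε / √t)) ^ 2 / (8 * ε ^ 2)) ^ t = exp (x ^ 2 / 2) := by
      rw [← exp_nat_mul]
      congr 1
      rw [mul_pow, div_pow, sq_sqrt htp.le]
      field_simp
      norm_num
    rw [e1] at h3
    have hYx : ∀ ω, x * Y a ω = x * (2 * ε / √t) * ∑ i ∈ Finset.Icc 1 t, Zis A R pol rbar a i ω := by
      intro ω; simp only [Y]; ring
    simp_rw [hYx]
    rw [← ofReal_integral_eq_lintegral_ofReal]
    · exact ENNReal.ofReal_le_ofReal h3
    · apply Integrable.of_bound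
        (measurable_exp.comp ((hZmeas a).const_mul _)).aestronglyMeasurable
        (exp (|x * (2 * ε / √t)| * c))
      filter_upwards [hc] with ω g
      rw [Function.comp_apply, Real.norm_eq_abs, abs_exp]
      apply exp_le_exp.2
      refine (le_abs_self _).trans ?_
      rw [abs_mul]
      gcongr
      exact g
    · exact Filter.Eventually.of_forall fun ω => (exp_pos _).le
  let M : Ω → ℝ := fun ω => ∑ a, μ a * exp (Y a ω ^ 2 / 4)
  have hMm : Measurable M := by
    apply Finset.measurable_sum
    intro a _
    have := hYm a
    fun_prop
  have hMe : ∫⁻ ω, ENNReal.ofReal (M ω) ∂P ≤ ENNReal.ofReal (√2) := by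
    have e : ∀ ω, ENNReal.ofReal (M ω) =
        ∑ a, ENNReal.ofReal (μ a) * ENNReal.ofReal (exp (Y a ω ^ 2 / 4)) := by
      intro ω
      rw [ENNReal.ofReal_sum_of_nonneg (fun a _ => mul_nonneg (hμ.1 a) (exp_pos _).le)]
      exact Finset.sum_congr rfl fun a _ => ENNReal.ofReal_mul (hμ.1 a)
    simp_rw [e]
    rw [lintegral_finsetSum]
    · calc _ ≤ ∑ a, ENNReal.ofReal (μ a) * ENNReal.ofReal (√2) := by
            apply Finset.sum_le_sum
            intro a _
            rw [lintegral_const_mul' _ _ (by simp)]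
            gcongr
            exact hYe a
        _ = _ := by
            rw [← Finset.sum_mul, ← ENNReal.ofReal_sum_of_nonneg (fun a _ => hμ.1 a), hμ.2]
            simp
    · intro a _
      have := hYm a
      fun_prop
  obtain ⟨hβ0, hβ1⟩ := hβ
  set C : ℝ := 4 * π / (3 * β) with hC
  have hCpos : 0 < C := by positivity
  have hCge : √2 / C ≤ β := by
    have h2 : √2 ≤ 2 := by
      rw [sqrt_le_left (by norm_num)]; norm_num
    rw [div_le_iff₀ hCpos, hC]
    have : β * (4 * π / (3 * β)) = 4 * π / 3 := by field_simp
    rw [this]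
    linarith [pi_gt_three]
  have hmeasS : MeasurableSet {ω | C ≤ M ω} := measurableSet_le measurable_const hMm
  have hbad : P {ω | C ≤ M ω} ≤ ENNReal.ofReal β := by
    have h := meas_ge_le_lintegral_div (μ := P) (f := fun ω => ENNReal.ofReal (M ω))
      hMm.ennreal_ofReal.aemeasurable (ε := ENNReal.ofReal C) (by simpa using hCpos) (by simp)
    calc P {ω | C ≤ M ω} ≤ P {ω | ENNReal.ofReal C ≤ ENNReal.ofReal (M ω)} :=
          measure_mono fun ω hω => ENNReal.ofReal_le_ofReal hω
      _ ≤ _ := h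
      _ ≤ ENNReal.ofReal (√2) / ENNReal.ofReal C := by gcongr
      _ = ENNReal.ofReal (√2 / C) := (ENNReal.ofReal_div_of_pos hCpos).symm
      _ ≤ _ := ENNReal.ofReal_le_ofReal hCge
  have hgood : 1 - β ≤ P.real {ω | C ≤ M ω}ᶜ := by
    rw [probReal_compl_eq_one_sub hmeasS]
    have : P.real {ω | C ≤ M ω} ≤ β := ENNReal.toReal_le_of_le_ofReal hβ0.le hbad
    linarith
  refine ge_iff_le.2 (hgood.trans ?_)
  refine measureReal_mono ?_ (measure_ne_top _ _)
  intro ω hω p hp hac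
  have hω' : ∑ a, μ a * exp (Y a ω ^ 2 / 4) ≤ C := (not_le.1 (show ¬ C ≤ M ω from hω)).le
  have hdv := dv_step p μ (fun a => Y a ω ^ 2 / 4) hp.1 hp.2 hμ.1 hac C hCpos hω'
  have hYD : ∀ a, Y a ω ^ 2 / 4 = ε ^ 2 * t * (rbar a - rIS A R pol t a ω) ^ 2 := by
    intro a
    simp only [Y, Zis, rIS, Finset.sum_sub_distrib, Finset.sum_const, Nat.card_Icc,
      Nat.add_sub_cancel, nsmul_eq_mul]
    rw [mul_pow, div_pow, sq_sqrt htp.le]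
    field_simp
    ring
  have hj := jensen_sq p (fun a => rbar a - rIS A R pol t a ω) hp.1 hp.2
  have e3 : rPol rbar p - rISPol A R pol t p ω = ∑ a, p a * (rbar a - rIS A R pol t a ω) := by
    rw [rPol, rISPol, ← Finset.sum_sub_distrib]
    exact Finset.sum_congr rfl fun a _ => by ring
  have e4 : ∑ a, p a * (Y a ω ^ 2 / 4) =
      ε ^ 2 * t * ∑ a, p a * (rbar a - rIS A R pol t a ω) ^ 2 := by
    rw [Finset.mul_sum]
    exact Finset.sum_congr rfl fun a _ => by rw [hYD]; ring
  rw [e4] at hdv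
  rw [e3]
  set D := ∑ a, p a * (rbar a - rIS A R pol t a ω)
  have hfin : (ε * |D|) ^ 2 ≤ (KL p μ + log C) / t := by
    rw [le_div_iff₀ htp, mul_pow, sq_abs]
    calc ε ^ 2 * D ^ 2 * t = ε ^ 2 * t * D ^ 2 := by ring
      _ ≤ _ := mul_le_mul_of_nonneg_left hj (by positivity)
      _ ≤ _ := hdv
  have := Real.le_sqrt_of_sq_le hfin
  rw [one_div, inv_mul_eq_div, le_div_iff₀ hε0]
  linarith

end OfflineBandits
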